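/- There exist a polynomial p with rational coefficients of degree at most 11 and an integer N such that for all n ≥ N, the number of permutations of length n avoiding both 4321 and 1324 equals p(n). -/

import Mathlib

/-- A list of naturals is a permutation (in one-line notation) of `1,…,n`
where `n` is its length. -/
def IsPermList (l : List ℕ) : Prop :=
  l.Perm ((List.range l.length).map (· + 1))

/-- `f` is an occurrence of the pattern `β` in `π`: a strictly increasing
choice of indices of `π` whose entries are order isomorphic to `β`. -/
def IsOccurrence (π β : List ℕ) (f : Fin β.length → Fin π.length) : Prop :=
  StrictMono f ∧ ∀ s t : Fin β.length, π.get (f s) < π.get (f t) ↔ β.get s < β.get t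

/-- `π` contains the pattern `β`. -/
def PContains (π β : List ℕ) : Prop :=
  ∃ f : Fin β.length → Fin π.length, IsOccurrence π β f

/-- `π` avoids the pattern `β`. -/
def PAvoids (π β : List ℕ) : Prop :=
  ¬ PContains π β

/-- The class of permutations avoiding every member of `B`. -/
def Av (B : Set (List ℕ)) : Set (List ℕ) :=
  {π | IsPermList π ∧ ∀ β ∈ B, PAvoids π β}

/-- Insert a new maximum entry at (0-indexed) position `i` of `l`. -/
def insertMax (l : List ℕ) (i : ℕ) : List ℕ :=
  l.insertIdx i (l.length + 1)

/-- Position `i` is an active site of `l` relative to `B`. -/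
def ActiveSite (B : Set (List ℕ)) (l : List ℕ) (i : ℕ) : Prop :=
  i ≤ l.length ∧ insertMax l i ∈ Av B

/-- The increasing permutation `1,2,…,n`. -/
def incrPerm (n : ℕ) : List ℕ :=
  (List.range n).map (· + 1)

/-- A permutation (as a list) is a vertical alternation: every entry in an even
(1-indexed) position lies above every entry in an odd position, or vice versa.
(Index `s : Fin l.length` corresponds to 1-indexed position `s + 1`.) -/
def VerticalAlternation (l : List ℕ) : Prop :=
  (∀ s t : Fin l.length, s.val % 2 = 1 → t.val % 2 = 0 → l.get t < l.get s) ∨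
  (∀ s t : Fin l.length, s.val % 2 = 1 → t.val % 2 = 0 → l.get s < l.get t)

/-- The subsequence of entries in positions congruent to `r` (0-indexed, mod 2)
is increasing. -/
def IncOnRes (l : List ℕ) (r : ℕ) : Prop :=
  ∀ s t : Fin l.length, s < t → s.val % 2 = r → t.val % 2 = r → l.get s < l.get t

/-- The subsequence of entries in positions congruent to `r` (0-indexed, mod 2)
is decreasing. -/
def DecOnRes (l : List ℕ) (r : ℕ) : Prop :=
  ∀ s t : Fin l.length, s < t → s.val % 2 = r → t.val % 2 = r → l.get t < l.get s

/-- A vertical parallel alternation: a vertical alternation of even length whose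
odd-position and even-position subsequences are both increasing or both decreasing. -/
def IsVertParallel (l : List ℕ) : Prop :=
  VerticalAlternation l ∧ Even l.length ∧
    ((IncOnRes l 0 ∧ IncOnRes l 1) ∨ (DecOnRes l 0 ∧ DecOnRes l 1))

/-- A vertical wedge alternation: a vertical alternation of even length for which one of
the odd-position and even-position subsequences is increasing and the other decreasing. -/
def IsVertWedge (l : List ℕ) : Prop :=
  VerticalAlternation l ∧ Even l.length ∧
    ((IncOnRes l 0 ∧ DecOnRes l 1) ∨ (DecOnRes l 0 ∧ IncOnRes l 1))

/-- The vertical parallel alternation `σ_m`, with `σ_m(2i−1) = m+1−i` and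
`σ_m(2i) = 2m+1−i` (1-indexed). -/
def sigmaAlt (m : ℕ) : List ℕ :=
  (List.range (2 * m)).map (fun j => if j % 2 = 0 then m - j / 2 else 2 * m - j / 2)

/-- The vertical wedge alternation `τ_m`, with `τ_m(2i−1) = m+i` and
`τ_m(2i) = m+1−i` (1-indexed). -/
def tauAlt (m : ℕ) : List ℕ :=
  (List.range (2 * m)).map (fun j => if j % 2 = 0 then m + j / 2 + 1 else m - j / 2)

/-- Standardization: replace each entry of `l` by its rank among the entries of `l`. -/
def stList (l : List ℕ) : List ℕ :=
  l.map (fun x => (l.filter (fun y => y ≤ x)).length)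


/-- No four entries of `l` form a `4321` or a `1324`. -/
def AvoidsBoth (l : List ℕ) : Prop :=
  ∀ a b c d, [a, b, c, d].Sublist l → ¬(d < c ∧ c < b ∧ b < a) ∧ ¬(a < c ∧ c < b ∧ b < d)

theorem pAvoids_4321_1324_iff (l : List ℕ) :
    (PAvoids l [4, 3, 2, 1] ∧ PAvoids l [1, 3, 2, 4]) ↔ AvoidsBoth l := by
  constructor
  · rintro ⟨h1, h2⟩ a b c d hs
    obtain ⟨f, hf⟩ := List.sublist_iff_exists_fin_orderEmbedding_get_eq.1 hs
    refine ⟨fun h => h1 ⟨f, f.strictMono, ?_⟩, fun h => h2 ⟨f, f.strictMono, ?_⟩⟩ <;>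
    · intro s t
      rw [← hf s, ← hf t]
      change Fin 4 at s t
      fin_cases s <;> fin_cases t <;> simp <;> omega
  · intro h
    constructor <;>
    · rintro ⟨f, hf, ho⟩
      have hs : [l.get (f 0), l.get (f 1), l.get (f 2), l.get (f 3)].Sublist l := by
        refine List.sublist_iff_exists_fin_orderEmbedding_get_eq.2
          ⟨OrderEmbedding.ofStrictMono f hf, fun ix => ?_⟩
        change Fin 4 at ix
        fin_cases ix <;> rfl
      have := h _ _ _ _ hs
      have h01 := ho 0 1
      have h10 := ho 1 0
      have h12 := ho 1 2
      have h21 := ho 2 1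
      have h23 := ho 2 3
      have h02 := ho 0 2
      have h13 := ho 1 3
      have h32 := ho 3 2
      simp at h01 h10 h12 h21 h23 h02 h13 h32 this
      omega

theorem AvoidsBoth.sublist {l l' : List ℕ} (h : AvoidsBoth l) (hs : l'.Sublist l) :
    AvoidsBoth l' :=
  fun a b c d h' => h a b c d (h'.trans hs)

theorem avoidsBoth_map_iff {f : ℕ → ℕ} (hf : StrictMono f) (l : List ℕ) :
    AvoidsBoth (l.map f) ↔ AvoidsBoth l := by
  constructor
  · intro h a b c d hs
    simpa [hf.lt_iff_lt] using h _ _ _ _ (hs.map f)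
  · intro h a b c d hs
    obtain ⟨l', hl', e⟩ := List.sublist_map_iff.1 hs
    match l', e with
    | [a', b', c', d'], e =>
      simp only [List.map_cons, List.map_nil, List.cons.injEq, and_true] at e
      obtain ⟨rfl, rfl, rfl, rfl⟩ := e
      simpa [hf.lt_iff_lt] using h _ _ _ _ hl'

theorem isPermList_iff (l : List ℕ) :
    IsPermList l ↔ l.Nodup ∧ ∀ x, x ∈ l ↔ 1 ≤ x ∧ x ≤ l.length := by
  have hn : ((List.range l.length).map (· + 1)).Nodup :=
    List.nodup_range.map (add_left_injective 1)
  have hm : ∀ x, x ∈ (List.range l.length).map (· + 1) ↔ 1 ≤ x ∧ x ≤ l.length := by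
    intro x
    simp only [List.mem_map, List.mem_range]
    exact ⟨by rintro ⟨y, hy, rfl⟩; omega, fun h => ⟨x - 1, by omega, by omega⟩⟩
  constructor
  · intro h
    exact ⟨h.nodup_iff.2 hn, fun x => h.mem_iff.trans (hm x)⟩
  · rintro ⟨h1, h2⟩
    exact (List.perm_ext_iff_of_nodup h1 hn).2 fun x => (h2 x).trans (hm x).symm

/-- Skip the value `v + 1`. -/
def upFrom (v x : ℕ) : ℕ := bif Nat.ble x v then x else x + 1

theorem upFrom_eq (v x : ℕ) : upFrom v x = if x ≤ v then x else x + 1 := by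
  by_cases h : x ≤ v
  · simp [upFrom, Nat.ble_eq_true_of_le h, h]
  · simp [upFrom, h, Bool.eq_false_iff.2 (mt Nat.le_of_ble_eq_true h)]

theorem upFrom_self (v : ℕ) : upFrom v v = v := by simp [upFrom_eq]

theorem upFrom_ne (v x : ℕ) : upFrom v x ≠ v + 1 := by
  rw [upFrom_eq]; split_ifs <;> omega

theorem strictMono_upFrom (v : ℕ) : StrictMono (upFrom v) := by
  intro x y h
  simp only [upFrom_eq]
  split_ifs <;> omega

theorem exists_upFrom_eq {v x : ℕ} (h : x ≠ v + 1) : ∃ y, upFrom v y = x := by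
  by_cases hx : x ≤ v
  · exact ⟨x, by simp [upFrom_eq, hx]⟩
  · exact ⟨x - 1, by rw [upFrom_eq, if_neg (by omega)]; omega⟩

theorem succ_notMem_map_upFrom {v : ℕ} {l : List ℕ} : v + 1 ∉ l.map (upFrom v) := by
  simp only [List.mem_map, not_exists, not_and]
  exact fun x _ => upFrom_ne v x

/-- The result of replacing the entry `v` of `A ++ v :: B` by two consecutive entries `v, v + 1`. -/
def double (A : List ℕ) (v : ℕ) (B : List ℕ) : List ℕ :=
  A.map (upFrom v) ++ v :: (v + 1) :: B.map (upFrom v)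

theorem length_double (A : List ℕ) (v : ℕ) (B : List ℕ) :
    (double A v B).length = (A ++ v :: B).length + 1 := by
  simp [double]; omega

theorem map_upFrom_sublist_double (A : List ℕ) (v : ℕ) (B : List ℕ) :
    ((A ++ v :: B).map (upFrom v)).Sublist (double A v B) := by
  rw [List.map_append, List.map_cons, upFrom_self]
  exact ((List.sublist_cons_self _ _).cons_cons v).append_left _

theorem nodup_double_iff (A : List ℕ) (v : ℕ) (B : List ℕ) :
    (double A v B).Nodup ↔ (A ++ v :: B).Nodup := by
  have hi := (strictMono_upFrom v).injective
  refine ⟨fun h => ((List.nodup_map_iff hi).1 (h.sublist (map_upFrom_sublist_double A v B))),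
    fun h => ?_⟩
  have hp : (double A v B).Perm ((v + 1) :: (A ++ v :: B).map (upFrom v)) := by
    rw [List.map_append, List.map_cons, upFrom_self]
    have e : double A v B = (A.map (upFrom v) ++ [v]) ++ (v + 1) :: B.map (upFrom v) := by
      simp [double]
    rw [e]
    refine List.perm_middle.trans ?_
    simp
  rw [hp.nodup_iff, List.nodup_cons]
  exact ⟨succ_notMem_map_upFrom, h.map hi⟩

theorem mem_double {A B : List ℕ} {v x : ℕ} :
    x ∈ double A v B ↔ x = v + 1 ∨ ∃ y ∈ A ++ v :: B, upFrom v y = x := by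
  rw [← List.mem_map, List.map_append, List.map_cons, upFrom_self]
  simp only [double, List.mem_append, List.mem_cons]
  tauto

theorem isPermList_double_iff (A : List ℕ) (v : ℕ) (B : List ℕ) :
    IsPermList (double A v B) ↔ IsPermList (A ++ v :: B) := by
  simp only [isPermList_iff, nodup_double_iff, length_double]
  refine and_congr_right fun _ => ⟨fun h x => ?_, fun h x => ?_⟩
  · have hv := (h (v + 1)).1 (mem_double.2 (Or.inl rfl))
    have hx : upFrom v x ∈ double A v B ↔ x ∈ A ++ v :: B := by
      rw [mem_double]
      constructor
      · rintro (h | ⟨y, hy, e⟩)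
        · exact absurd h (upFrom_ne v x)
        · rwa [← (strictMono_upFrom v).injective e]
      · exact fun h => Or.inr ⟨x, h, rfl⟩
    rw [← hx, h, upFrom_eq]
    split_ifs <;> omega
  · have hv := (h v).1 (by simp)
    rw [mem_double]
    by_cases hx : x = v + 1
    · exact ⟨fun _ => ⟨by omega, by omega⟩, fun _ => Or.inl hx⟩
    · obtain ⟨y, rfl⟩ := exists_upFrom_eq hx
      have : (∃ z ∈ A ++ v :: B, upFrom v z = upFrom v y) ↔ y ∈ A ++ v :: B :=
        ⟨fun ⟨z, hz, e⟩ => (strictMono_upFrom v).injective e ▸ hz, fun h => ⟨y, h, rfl⟩⟩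
      rw [this, h]
      simp only [hx, false_or]
      rw [upFrom_eq]
      split_ifs <;> omega

theorem not_sublist_of_adjacent {X Y : List ℕ} {v w b : ℕ} (hn : (X ++ v :: w :: Y).Nodup) :
    ¬ [v, b, w].Sublist (X ++ v :: w :: Y) := by
  intro h
  have hv : v ∉ X ∧ v ∉ w :: Y ∧ w ∉ Y := by
    simp only [List.nodup_append, List.nodup_cons, List.mem_cons] at hn ⊢
    exact ⟨fun hX => hn.2.2 v hX v (Or.inl rfl) rfl, hn.2.1.1, hn.2.1.2.1⟩
  obtain ⟨l₁, l₂, e, h₁, h₂⟩ := List.sublist_append_iff.1 h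
  cases l₁ with
  | cons a l₁ =>
    obtain rfl : v = a := (List.cons.inj e).1
    exact hv.1 (h₁.subset (by simp))
  | nil =>
    obtain rfl : [v, b, w] = l₂ := e
    rcases List.cons_sublist_cons'.1 h₂ with h₃ | ⟨-, h₃⟩
    · exact hv.2.1 (h₃.subset (by simp))
    · rcases List.cons_sublist_cons'.1 h₃ with h₄ | ⟨-, h₄⟩
      · exact hv.2.2 (h₄.subset (by simp))
      · exact hv.2.2 (h₄.subset (by simp))

theorem not_sublist_swap_of_adjacent {X Y : List ℕ} {v w : ℕ} (hn : (X ++ v :: w :: Y).Nodup) :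
    ¬ [w, v].Sublist (X ++ v :: w :: Y) := by
  intro h
  have hv : v ∉ w :: Y ∧ w ∉ X ∧ w ∉ Y := by
    simp only [List.nodup_append, List.nodup_cons, List.mem_cons] at hn ⊢
    exact ⟨hn.2.1.1, fun hX => hn.2.2 w hX w (Or.inr (Or.inl rfl)) rfl, hn.2.1.2.1⟩
  obtain ⟨l₁, l₂, e, h₁, h₂⟩ := List.sublist_append_iff.1 h
  cases l₁ with
  | cons a l₁ =>
    obtain rfl : w = a := (List.cons.inj e).1
    exact hv.2.1 (h₁.subset (by simp))
  | nil =>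
    obtain rfl : [w, v] = l₂ := e
    rcases List.cons_sublist_cons'.1 h₂ with h₃ | ⟨rfl, -⟩
    · rcases List.cons_sublist_cons'.1 h₃ with h₄ | ⟨-, h₄⟩
      · exact hv.2.2 (h₄.subset (by simp))
      · exact hv.1 (List.mem_cons_of_mem _ (h₄.subset (by simp)))
    · exact hv.1 (by simp)

theorem sublist_append_of_notMem {l X Y : List ℕ} {w : ℕ} (h : l.Sublist (X ++ w :: Y))
    (hw : w ∉ l) : l.Sublist (X ++ Y) := by
  obtain ⟨l₁, l₂, rfl, h₁, h₂⟩ := List.sublist_append_iff.1 h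
  refine h₁.append ?_
  rcases List.sublist_cons_iff.1 h₂ with h₃ | ⟨r, rfl, -⟩
  · exact h₃
  · simp at hw

theorem map_upFrom_eq_of_notMem {l : List ℕ} {v : ℕ} (h : v ∉ l) :
    l.map (upFrom v) = l.map (fun x => if x < v then x else x + 1) := by
  refine List.map_congr_left fun x hx => ?_
  have : x ≠ v := fun e => h (e ▸ hx)
  rw [upFrom_eq]
  split_ifs <;> omega

theorem notMem_of_nodup_append_cons {A B : List ℕ} {v : ℕ} (h : (A ++ v :: B).Nodup) :
    v ∉ A ∧ v ∉ B := by
  have := List.nodup_middle.1 h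
  simpa using (List.nodup_cons.1 this).1

theorem avoidsBoth_double_iff {A B : List ℕ} {v : ℕ} (hn : (A ++ v :: B).Nodup) :
    AvoidsBoth (double A v B) ↔ AvoidsBoth (A ++ v :: B) := by
  refine ⟨fun h => (avoidsBoth_map_iff (strictMono_upFrom v) _).1
    (h.sublist (map_upFrom_sublist_double A v B)), fun h a b c d hs => ?_⟩
  have hd := (nodup_double_iff A v B).2 hn
  by_cases h1 : v + 1 ∈ [a, b, c, d]
  · by_cases h0 : v ∈ [a, b, c, d]
    · have swap : ∀ x y, [x, y].Sublist [a, b, c, d] → ¬(x = v + 1 ∧ y = v) := by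
        rintro x y hxy ⟨rfl, rfl⟩
        exact not_sublist_swap_of_adjacent hd (hxy.trans hs)
      have between : ∀ x y z, [x, y, z].Sublist [a, b, c, d] → ¬(x = v ∧ z = v + 1) := by
        rintro x y z hxy ⟨rfl, rfl⟩
        exact not_sublist_of_adjacent hd (hxy.trans hs)
      have s1 := swap a b (by simp)
      have s2 := swap b c (List.Sublist.cons a (.cons_cons b (.cons_cons c (List.nil_sublist _))))
      have s3 := swap c d (by simp)
      have s4 := swap a c (List.Sublist.cons_cons a (.cons b (.cons_cons c (List.nil_sublist _))))
      have s5 := swap a d (List.Sublist.cons_cons a (.cons b (.cons c (.cons_cons d .slnil))))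
      have s6 := swap b d (List.Sublist.cons a (.cons_cons b (.cons c (.cons_cons d .slnil))))
      have t1 := between a b c
        (List.Sublist.cons_cons a (.cons_cons b (.cons_cons c (List.nil_sublist _))))
      have t2 := between b c d (List.sublist_cons_self _ _)
      simp only [List.mem_cons, List.not_mem_nil, or_false] at h0 h1
      omega
    · have hs' : [a, b, c, d].Sublist (A.map (upFrom v) ++ (v + 1) :: B.map (upFrom v)) :=
        sublist_append_of_notMem hs h0
      have hAB := notMem_of_nodup_append_cons hn
      rw [map_upFrom_eq_of_notMem hAB.1, map_upFrom_eq_of_notMem hAB.2] at hs'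
      have hm : StrictMono fun x => if x < v then x else x + 1 := by
        intro x y hxy
        dsimp only
        split_ifs <;> omega
      refine (avoidsBoth_map_iff hm (A ++ v :: B)).2 h a b c d ?_
      simpa using hs'
  · refine (avoidsBoth_map_iff (strictMono_upFrom v) (A ++ v :: B)).2 h a b c d ?_
    have e : double A v B = (A.map (upFrom v) ++ [v]) ++ (v + 1) :: B.map (upFrom v) := by
      simp [double]
    rw [e] at hs
    simpa [upFrom_self] using sublist_append_of_notMem hs h1

/-- The entries `x` of a list that are immediately followed by `x + 1`. -/
def succs : List ℕ → List ℕ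
  | [] => []
  | [_] => []
  | x :: y :: t => bif Nat.beq y (x + 1) then x :: succs (y :: t) else succs (y :: t)

theorem succs_cons_cons (x y : ℕ) (t : List ℕ) :
    succs (x :: y :: t) = if y = x + 1 then x :: succs (y :: t) else succs (y :: t) := by
  by_cases h : y = x + 1
  · subst h; simp [succs]
  · have : Nat.beq y (x + 1) = false := Bool.eq_false_iff.2 (mt Nat.eq_of_beq_eq_true h)
    simp [succs, h, this]

theorem succs_sublist : ∀ l : List ℕ, (succs l).Sublist l
  | [] => by simp [succs]
  | [_] => by simp [succs]
  | x :: y :: t => by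
    have := succs_sublist (y :: t)
    rw [succs_cons_cons]
    split_ifs
    · exact this.cons_cons x
    · exact this.cons x

theorem succs_append (A : List ℕ) (x : ℕ) (B : List ℕ) :
    succs (A ++ x :: B) = succs (A ++ [x]) ++ succs (x :: B) := by
  induction A with
  | nil => simp [succs]
  | cons a A ih =>
    cases A with
    | nil =>
      simp only [List.cons_append, List.nil_append, succs_cons_cons, succs]
      split_ifs <;> simp
    | cons b A =>
      simp only [List.cons_append, succs_cons_cons] at ih ⊢
      split_ifs <;> simp [ih]

theorem mem_succs_iff (v : ℕ) (l : List ℕ) :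
    v ∈ succs l ↔ ∃ A B, l = A ++ v :: (v + 1) :: B := by
  constructor
  · induction l with
    | nil => simp [succs]
    | cons x l ih =>
      cases l with
      | nil => simp [succs]
      | cons y t =>
        rw [succs_cons_cons]
        intro h
        have h' : (v = x ∧ y = x + 1) ∨ v ∈ succs (y :: t) := by
          split_ifs at h with e
          · simp only [List.mem_cons] at h; tauto
          · exact Or.inr h
        rcases h' with ⟨rfl, rfl⟩ | h'
        · exact ⟨[], t, rfl⟩
        · obtain ⟨A, B, e⟩ := ih h'
          exact ⟨x :: A, B, by rw [e]; rfl⟩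
  · rintro ⟨A, B, rfl⟩
    rw [succs_append, succs_cons_cons]
    simp

theorem length_succs_lt (x : ℕ) (l : List ℕ) : (succs (x :: l)).length < (x :: l).length := by
  induction l generalizing x with
  | nil => simp [succs]
  | cons y t ih =>
    have := ih y
    rw [succs_cons_cons]
    split_ifs <;> simp only [List.length_cons] at this ⊢ <;> omega

theorem length_succs_map_upFrom {A : List ℕ} {v : ℕ} (h : v ∉ A) :
    (succs (A.map (upFrom v) ++ [v])).length = (succs (A ++ [v])).length := by
  induction A with
  | nil => rfl
  | cons a A ih =>
    simp only [List.mem_cons, not_or] at h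
    have ih := ih h.2
    have key : ∀ y, upFrom v y = upFrom v a + 1 ↔ y = a + 1 := by
      intro y
      simp only [upFrom_eq]
      split_ifs <;> omega
    cases A with
    | nil =>
      have := key v
      rw [upFrom_self] at this
      simp only [List.map_cons, List.map_nil, List.cons_append, List.nil_append, succs_cons_cons,
        this]
      split_ifs <;> rfl
    | cons b A =>
      simp only [List.map_cons, List.cons_append, succs_cons_cons, key] at ih ⊢
      split_ifs <;> simp [ih]

theorem length_succs_map_of_notMem {B : List ℕ} {v : ℕ} (h : v ∉ B) (x : ℕ) :
    (succs ((x :: B).map fun x => if x < v then x else x + 1)).length =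
      (succs (x :: B)).length := by
  induction B generalizing x with
  | nil => rfl
  | cons b B ih =>
    simp only [List.mem_cons, not_or] at h
    have ih := ih h.2 b
    have key : (if b < v then b else b + 1) = (if x < v then x else x + 1) + 1 ↔ b = x + 1 := by
      split_ifs <;> omega
    simp only [List.map_cons, succs_cons_cons, key] at ih ⊢
    by_cases e : b = x + 1
    · simp only [e, if_true, List.length_cons] at ih ⊢
      rw [ih]
    · simp only [e, if_false, ih]

theorem length_succs_double {A B : List ℕ} {v : ℕ} (hn : (A ++ v :: B).Nodup) :
    (succs (double A v B)).length = (succs (A ++ v :: B)).length + 1 := by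
  have hAB := notMem_of_nodup_append_cons hn
  have hB := length_succs_map_of_notMem hAB.2 v
  simp only [List.map_cons, lt_irrefl, if_false] at hB
  rw [double, succs_append, succs_append A, succs_cons_cons, if_pos rfl,
    map_upFrom_eq_of_notMem hAB.2]
  simp only [List.length_append, List.length_cons, length_succs_map_upFrom hAB.1, hB]
  omega
theorem exists_map_upFrom_eq {v : ℕ} {X : List ℕ} (h : v + 1 ∉ X) :
    ∃ A : List ℕ, A.map (upFrom v) = X := by
  induction X with
  | nil => exact ⟨[], rfl⟩
  | cons x X ih =>
    simp only [List.mem_cons, not_or] at h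
    obtain ⟨A, rfl⟩ := ih h.2
    obtain ⟨y, rfl⟩ := exists_upFrom_eq (Ne.symm h.1)
    exact ⟨y :: A, rfl⟩

theorem exists_double_eq {X Y : List ℕ} {v : ℕ} (hn : (X ++ v :: (v + 1) :: Y).Nodup) :
    ∃ A B, A.map (upFrom v) = X ∧ B.map (upFrom v) = Y ∧
      X ++ v :: (v + 1) :: Y = double A v B := by
  have h := notMem_of_nodup_append_cons (A := X ++ [v]) (v := v + 1) (B := Y) (by simpa using hn)
  obtain ⟨A, rfl⟩ := exists_map_upFrom_eq (v := v) (X := X) fun h' => h.1 (by simp [h'])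
  obtain ⟨B, rfl⟩ := exists_map_upFrom_eq h.2
  exact ⟨A, B, rfl, rfl, rfl⟩

theorem erase_double (A : List ℕ) (v : ℕ) (B : List ℕ) :
    (double A v B).erase (v + 1) = (A ++ v :: B).map (upFrom v) := by
  rw [double, List.erase_append_right _ succ_notMem_map_upFrom,
    List.erase_cons_tail (by simp), List.erase_cons_head]
  simp [upFrom_self]

/-- The permutations of length `n` avoiding `4321` and `1324`. -/
noncomputable def avoiders (n : ℕ) : Finset (List ℕ) :=
  open Classical in {l ∈ ((List.range n).map (· + 1)).permutations.toFinset | AvoidsBoth l}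

theorem mem_avoiders {n : ℕ} {l : List ℕ} :
    l ∈ avoiders n ↔ IsPermList l ∧ l.length = n ∧ AvoidsBoth l := by
  simp only [avoiders, Finset.mem_filter, List.mem_toFinset, List.mem_permutations, ← and_assoc]
  refine and_congr_left fun _ => ⟨fun h => ?_, ?_⟩
  · have hl : l.length = n := by simpa using h.length_eq
    subst hl
    exact ⟨h, rfl⟩
  · rintro ⟨h, rfl⟩
    exact h

theorem nodup_of_mem_avoiders {n : ℕ} {l : List ℕ} (h : l ∈ avoiders n) : l.Nodup :=
  ((isPermList_iff l).1 (mem_avoiders.1 h).1).1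

theorem mem_iff_of_mem_avoiders {n : ℕ} {l : List ℕ} (h : l ∈ avoiders n) (x : ℕ) :
    x ∈ l ↔ 1 ≤ x ∧ x ≤ n := by
  obtain ⟨hp, rfl, -⟩ := mem_avoiders.1 h
  exact ((isPermList_iff l).1 hp).2 x

theorem double_mem_avoiders_iff {n : ℕ} {A B : List ℕ} {v : ℕ} :
    double A v B ∈ avoiders (n + 1) ↔ A ++ v :: B ∈ avoiders n := by
  simp only [mem_avoiders, isPermList_double_iff, length_double, Nat.add_right_cancel_iff]
  exact and_congr_right fun h =>
    and_congr_right fun _ => avoidsBoth_double_iff ((isPermList_iff _).1 h).1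

theorem append_mem_avoiders {n : ℕ} {A B : List ℕ} (h : A ++ (n + 1) :: B ∈ avoiders (n + 1)) :
    A ++ B ∈ avoiders n := by
  have hn := List.nodup_cons.1 (List.nodup_middle.1 (nodup_of_mem_avoiders h))
  have hx := mem_iff_of_mem_avoiders h
  obtain ⟨-, hl, ha⟩ := mem_avoiders.1 h
  have hl' : (A ++ B).length = n := by simp at hl ⊢; omega
  refine mem_avoiders.2 ⟨(isPermList_iff _).2 ⟨hn.2, fun x => ?_⟩, hl',
    ha.sublist ((List.sublist_cons_self _ _).append_left _)⟩
  have hx := hx x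
  rw [hl']
  by_cases e : x = n + 1
  · subst e; simp only [hn.1, false_iff]; omega
  · have : x ∈ A ++ (n + 1) :: B ↔ x ∈ A ++ B := by simp [e]
    rw [← this, hx]; omega

/-- No entry `y` is followed by some `z` with `x < z < y`. -/
def no21Above (x : ℕ) : List ℕ → Bool
  | [] => true
  | y :: t => (Nat.ble y x || t.all fun z => Nat.ble z x || Nat.ble y z) && no21Above x t

/-- No three entries form a `132`. -/
def no132 : List ℕ → Bool
  | [] => true
  | x :: t => no21Above x t && no132 t

/-- No entry `y < x` is followed by a smaller entry. -/
def no21Below (x : ℕ) : List ℕ → Bool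
  | [] => true
  | y :: t => (Nat.ble x y || t.all fun z => Nat.ble y z) && no21Below x t

/-- No three entries form a `321`. -/
def no321 : List ℕ → Bool
  | [] => true
  | x :: t => no21Below x t && no321 t

theorem no21Above_of_sublist {x : ℕ} {l : List ℕ}
    (h : ∀ y z, [y, z].Sublist l → ¬(x < z ∧ z < y)) : no21Above x l = true := by
  induction l with
  | nil => rfl
  | cons y t ih =>
    simp only [no21Above, Bool.and_eq_true, Bool.or_eq_true, List.all_eq_true, Nat.ble_eq]
    refine ⟨Or.inr fun z hz => ?_, ih fun y z hs => h y z (hs.cons _)⟩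
    have := h y z ((List.singleton_sublist.2 hz).cons_cons y)
    omega

theorem no132_of_sublist {l : List ℕ}
    (h : ∀ x y z, [x, y, z].Sublist l → ¬(x < z ∧ z < y)) : no132 l = true := by
  induction l with
  | nil => rfl
  | cons x t ih =>
    simp only [no132, Bool.and_eq_true]
    exact ⟨no21Above_of_sublist fun y z hs => h x y z (hs.cons_cons x),
      ih fun x y z hs => h x y z (hs.cons _)⟩

theorem no21Below_of_sublist {x : ℕ} {l : List ℕ}
    (h : ∀ y z, [y, z].Sublist l → ¬(z < y ∧ y < x)) : no21Below x l = true := by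
  induction l with
  | nil => rfl
  | cons y t ih =>
    simp only [no21Below, Bool.and_eq_true, Bool.or_eq_true, List.all_eq_true, Nat.ble_eq]
    refine ⟨or_iff_not_imp_left.2 fun hxy z hz => ?_, ih fun y z hs => h y z (hs.cons _)⟩
    have := h y z ((List.singleton_sublist.2 hz).cons_cons y)
    omega

theorem no321_of_sublist {l : List ℕ}
    (h : ∀ x y z, [x, y, z].Sublist l → ¬(z < y ∧ y < x)) : no321 l = true := by
  induction l with
  | nil => rfl
  | cons x t ih =>
    simp only [no321, Bool.and_eq_true]
    exact ⟨no21Below_of_sublist fun y z hs => h x y z (hs.cons_cons x),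
      ih fun x y z hs => h x y z (hs.cons _)⟩

/-- All ways to write a list as a concatenation of two lists. -/
def splits : List ℕ → List (List ℕ × List ℕ)
  | [] => [([], [])]
  | x :: t => ([], x :: t) :: (splits t).map fun p => (x :: p.1, p.2)

theorem mem_splits_append (A B : List ℕ) : (A, B) ∈ splits (A ++ B) := by
  induction A with
  | nil => cases B <;> simp [splits]
  | cons a A ih => simp [splits, ih]

/-- The list `p.1 ++ n :: p.2`, kept if it passes the conditions that a maximum entry `n` imposes
and has no two consecutive entries `x, x + 1`. -/
def joinMax (n : ℕ) (p : List ℕ × List ℕ) : List (List ℕ) :=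
  bif no132 p.1 && (no321 p.2 && (succs (p.1 ++ n :: p.2)).isEmpty) then [p.1 ++ n :: p.2] else []

/-- Double the first entry of the second part, and insert `n` between the two copies. -/
def joinMaxDoubled (n : ℕ) : List ℕ × List ℕ → List (List ℕ)
  | (_, []) => []
  | (A, v :: B) => joinMax n (A.map (upFrom v) ++ [v], (v + 1) :: B.map (upFrom v))

/-- Candidates for the next list of `succFreePair`, given the previous two lists. -/
def extend (n : ℕ) (P Q : List (List ℕ)) : List (List ℕ) :=
  (Q.flatMap fun l => (splits l).flatMap (joinMax n)) ++
  (P.flatMap fun l => (splits l).flatMap (joinMaxDoubled n))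

/-- Lists containing all avoiders of lengths `n` and `n + 1` without two consecutive entries
`x, x + 1`. -/
def succFreePair : ℕ → List (List ℕ) × List (List ℕ)
  | 0 => ([[]], [[1]])
  | n + 1 => ((succFreePair n).2, extend (n + 2) (succFreePair n).1 (succFreePair n).2)

theorem mem_joinMax {n : ℕ} {A B : List ℕ} (h : A ++ n :: B ∈ avoiders n)
    (hs : succs (A ++ n :: B) = []) : A ++ n :: B ∈ joinMax n (A, B) := by
  obtain ⟨-, -, ha⟩ := mem_avoiders.1 h
  have hn := notMem_of_nodup_append_cons (nodup_of_mem_avoiders h)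
  have hlt : ∀ x ∈ A ++ B, x < n := by
    intro x hx
    have h1 := (mem_iff_of_mem_avoiders h x).1 (by simp at hx ⊢; tauto)
    have h2 : x ≠ n := by
      rintro rfl
      simp [hn] at hx
    omega
  have hA : no132 A = true := by
    refine no132_of_sublist fun x y z hxyz hlt' => ?_
    refine (ha x y z n ?_).2 ⟨hlt'.1, hlt'.2, hlt y ?_⟩
    · exact hxyz.append (List.singleton_sublist.2 (by simp : n ∈ n :: B))
    · exact List.mem_append_left _ (hxyz.subset (by simp))
  have hB : no321 B = true := by
    refine no321_of_sublist fun x y z hxyz hlt' => ?_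
    refine (ha n x y z ?_).1 ⟨hlt'.1, hlt'.2, hlt x ?_⟩
    · exact (hxyz.cons_cons n).trans (List.sublist_append_right A _)
    · exact List.mem_append_right _ (hxyz.subset (by simp))
  simp [joinMax, hA, hB, hs]

theorem mem_extend {m : ℕ} {P Q : List (List ℕ)}
    (hP : ∀ l ∈ avoiders m, succs l = [] → l ∈ P)
    (hQ : ∀ l ∈ avoiders (m + 1), succs l = [] → l ∈ Q)
    {l : List ℕ} (h : l ∈ avoiders (m + 2)) (hs : succs l = []) : l ∈ extend (m + 2) P Q := by
  have hmax : m + 2 ∈ l := (mem_iff_of_mem_avoiders h _).2 (by omega)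
  obtain ⟨A, B, rfl⟩ := List.append_of_mem hmax
  have hj := mem_joinMax h hs
  have hAB := append_mem_avoiders h
  rw [extend, List.mem_append]
  by_cases hs' : succs (A ++ B) = []
  · left
    exact List.mem_flatMap.2 ⟨_, hQ _ hAB hs', List.mem_flatMap.2 ⟨_, mem_splits_append A B, hj⟩⟩
  right
  obtain ⟨v, hv⟩ := List.exists_mem_of_ne_nil _ hs'
  obtain ⟨X, Y, e⟩ := (mem_succs_iff _ _).1 hv
  have hno : ∀ U V, A ++ (m + 2) :: B ≠ U ++ v :: (v + 1) :: V := by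
    intro U V e'
    have := (mem_succs_iff v _).2 ⟨U, V, e'⟩
    simp [hs] at this
  obtain ⟨rfl, rfl⟩ : A = X ++ [v] ∧ B = (v + 1) :: Y := by
    rcases List.append_eq_append_iff.1 e with ⟨C, -, rfl⟩ | ⟨C, rfl, e'⟩
    · exact absurd (by simp) (hno (A ++ (m + 2) :: C) Y)
    · match C, e' with
      | [], e' => exact absurd (by simp at e'; simp [← e']) (hno (X ++ [m + 2]) Y)
      | [a], e' =>
        simp only [List.cons_append, List.nil_append, List.cons.injEq] at e'
        exact ⟨by rw [e'.1], e'.2.symm⟩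
      | a :: b :: C, e' =>
        simp only [List.cons_append, List.cons.injEq] at e'
        obtain ⟨rfl, rfl, -⟩ := e'
        exact absurd (by simp) (hno X (C ++ (m + 2) :: B))
  rw [e] at hAB
  obtain ⟨A, B, rfl, rfl, e₂⟩ := exists_double_eq (nodup_of_mem_avoiders hAB)
  have hmem : A ++ v :: B ∈ avoiders m := double_mem_avoiders_iff.1 (e₂ ▸ hAB)
  have h₁ : succs (A.map (upFrom v) ++ [v]) = [] := by
    rw [List.append_assoc, List.singleton_append, succs_append, List.append_eq_nil_iff] at hs
    exact hs.1
  have h₂ : succs ((v + 1) :: B.map (upFrom v)) = [] := by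
    rw [List.append_cons, succs_append, List.append_eq_nil_iff] at hs
    exact hs.2
  have hlen := length_succs_double (nodup_of_mem_avoiders hmem)
  rw [double, succs_append, h₁, succs_cons_cons, if_pos rfl, h₂] at hlen
  have hs₂ : succs (A ++ v :: B) = [] := by
    rw [← List.length_eq_zero_iff]; simpa using hlen.symm
  exact List.mem_flatMap.2 ⟨_, hP _ hmem hs₂,
    List.mem_flatMap.2 ⟨_, mem_splits_append A (v :: B), hj⟩⟩

theorem mem_succFreePair (n : ℕ) :
    (∀ l ∈ avoiders n, succs l = [] → l ∈ (succFreePair n).1) ∧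
      ∀ l ∈ avoiders (n + 1), succs l = [] → l ∈ (succFreePair n).2 := by
  induction n with
  | zero =>
    constructor
    · intro l h _
      have := (mem_avoiders.1 h).2.1
      simp [succFreePair, List.length_eq_zero_iff.1 this]
    · intro l h _
      obtain ⟨a, rfl⟩ := List.length_eq_one_iff.1 (mem_avoiders.1 h).2.1
      have := (mem_iff_of_mem_avoiders h a).1 (by simp)
      simp [succFreePair]; omega
  | succ n ih => exact ⟨ih.2, fun l h hs => mem_extend ih.1 ih.2 h hs⟩

theorem succFreePair_thirteen : succFreePair 13 = ([], []) := by decide +kernel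

theorem succs_ne_nil_of_mem_avoiders {n : ℕ} (hn : 13 ≤ n) {l : List ℕ} (h : l ∈ avoiders n) :
    succs l ≠ [] := by
  have key : ∀ k, succFreePair (13 + k) = ([], []) := by
    intro k
    induction k with
    | zero => exact succFreePair_thirteen
    | succ k ih => rw [← add_assoc, succFreePair, ih]; rfl
  obtain ⟨k, rfl⟩ := Nat.exists_eq_add_of_le hn
  intro hs
  have := (mem_succFreePair (13 + k)).1 l h hs
  simp [key k] at this

/-- The avoiders of length `n` consisting of `k` maximal runs of consecutive entries
`x, x + 1, …`. -/
noncomputable def avoidersRuns (n k : ℕ) : Finset (List ℕ) :=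
  {l ∈ avoiders n | (succs l).length + k = n}

/-- Replace the entry `v` by two consecutive entries `v, v + 1`. -/
def doubleAt (v : ℕ) (l : List ℕ) : List ℕ :=
  l.flatMap fun x => if x = v then [v, v + 1] else [upFrom v x]

theorem doubleAt_append {A B : List ℕ} {v : ℕ} (hn : (A ++ v :: B).Nodup) :
    doubleAt v (A ++ v :: B) = double A v B := by
  have key : ∀ C : List ℕ, v ∉ C → doubleAt v C = C.map (upFrom v) := by
    intro C hC
    induction C with
    | nil => rfl
    | cons c C ih =>
      simp only [List.mem_cons, not_or] at hC
      have ih := ih hC.2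
      simp only [doubleAt] at ih
      simp [doubleAt, Ne.symm hC.1, ih]
  have hAB := notMem_of_nodup_append_cons hn
  have hA := key A hAB.1
  have hB := key B hAB.2
  simp only [doubleAt] at hA hB
  simp [doubleAt, double, hA, hB]

theorem card_avoidersRuns_succ_mul (n k : ℕ) :
    (avoidersRuns (n + 1) k).card * (n + 1 - k) = (avoidersRuns n k).card * n := by
  have h₁ : ((avoidersRuns (n + 1) k).sigma fun l => (succs l).toFinset).card =
      (avoidersRuns (n + 1) k).card * (n + 1 - k) := by
    rw [Finset.card_sigma, Finset.sum_const_nat]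
    intro l hl
    simp only [avoidersRuns, Finset.mem_filter] at hl
    rw [List.toFinset_card_of_nodup ((nodup_of_mem_avoiders hl.1).sublist (succs_sublist l))]
    omega
  have h₂ : ((avoidersRuns n k).sigma fun _ => Finset.Icc 1 n).card =
      (avoidersRuns n k).card * n := by
    rw [Finset.card_sigma, Finset.sum_const_nat]
    simp
  rw [← h₁, ← h₂]
  symm
  have hdec : ∀ {l : List ℕ} {v : ℕ}, l ∈ avoidersRuns n k → v ∈ Finset.Icc 1 n →
      ∃ A B, l = A ++ v :: B ∧ l.Nodup := by
    intro l v hl hv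
    have hl := (Finset.mem_filter.1 hl).1
    obtain ⟨A, B, e⟩ := List.append_of_mem
      ((mem_iff_of_mem_avoiders hl v).2 (Finset.mem_Icc.1 hv))
    exact ⟨A, B, e, nodup_of_mem_avoiders hl⟩
  refine Finset.card_bij (fun p _ => ⟨doubleAt p.2 p.1, p.2⟩) ?_ ?_ ?_
  · rintro ⟨l, v⟩ h
    obtain ⟨hl, hv⟩ := Finset.mem_sigma.1 h
    dsimp only at hl hv
    obtain ⟨A, B, rfl, hn⟩ := hdec hl hv
    simp only [Finset.mem_sigma, List.mem_toFinset, avoidersRuns, Finset.mem_filter,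
      doubleAt_append hn, double_mem_avoiders_iff, length_succs_double hn, mem_succs_iff] at hl ⊢
    exact ⟨⟨hl.1, by omega⟩, _, _, rfl⟩
  · rintro ⟨l, v⟩ h ⟨l', v'⟩ h' e
    simp only [Sigma.mk.injEq, heq_eq_eq] at e
    obtain ⟨e, rfl⟩ := e
    obtain ⟨hl, hv⟩ := Finset.mem_sigma.1 h
    obtain ⟨hl', hv'⟩ := Finset.mem_sigma.1 h'
    dsimp only at hl hv hl' hv'
    obtain ⟨A, B, rfl, hn⟩ := hdec hl hv
    obtain ⟨A', B', rfl, hn'⟩ := hdec hl' hv'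
    rw [doubleAt_append hn, doubleAt_append hn'] at e
    have e := congrArg (fun l => l.erase (v + 1)) e
    simp only [erase_double] at e
    rw [List.map_injective_iff.2 (strictMono_upFrom v).injective e]
  · rintro ⟨l, v⟩ h
    simp only [Finset.mem_sigma, List.mem_toFinset, avoidersRuns, Finset.mem_filter] at h
    obtain ⟨⟨hl, hk⟩, hv⟩ := h
    obtain ⟨X, Y, rfl⟩ := (mem_succs_iff _ _).1 hv
    obtain ⟨A, B, -, -, e⟩ := exists_double_eq (nodup_of_mem_avoiders hl)
    rw [e] at hl hk ⊢
    have hl := double_mem_avoiders_iff.1 hl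
    have hn := nodup_of_mem_avoiders hl
    rw [length_succs_double hn] at hk
    refine ⟨⟨A ++ v :: B, v⟩, ?_, ?_⟩
    · simp only [Finset.mem_sigma, avoidersRuns, Finset.mem_filter, Finset.mem_Icc]
      exact ⟨⟨hl, by omega⟩, (mem_iff_of_mem_avoiders hl v).1 (by simp)⟩
    · simp only [doubleAt_append hn]

theorem card_avoidersRuns (k m : ℕ) :
    (avoidersRuns (k + 1 + m) (k + 1)).card =
      (avoidersRuns (k + 1) (k + 1)).card * (k + m).choose k := by
  induction m with
  | zero => simp
  | succ m ih =>
    have h := card_avoidersRuns_succ_mul (k + 1 + m) (k + 1)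
    have hc := Nat.choose_mul_succ_eq (k + m) k
    rw [ih, show k + 1 + m + 1 - (k + 1) = m + 1 by omega] at h
    rw [show k + m + 1 - k = m + 1 by omega] at hc
    refine Nat.eq_of_mul_eq_mul_right (Nat.succ_pos m) ?_
    calc _ = _ := h
      _ = (avoidersRuns (k + 1) (k + 1)).card * ((k + m).choose k * (k + m + 1)) := by ring
      _ = _ := by rw [hc, ← mul_assoc, ← add_assoc]

theorem avoidersRuns_self_eq_empty {k : ℕ} (hk : 13 ≤ k) : avoidersRuns k k = ∅ := by
  refine Finset.eq_empty_of_forall_notMem fun l hl => ?_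
  simp only [avoidersRuns, Finset.mem_filter] at hl
  exact succs_ne_nil_of_mem_avoiders hk hl.1 (List.length_eq_zero_iff.1 (by omega))

theorem card_avoiders_succ (n : ℕ) :
    (avoiders (n + 1)).card =
      ∑ k ∈ Finset.range 12, (avoidersRuns (k + 1) (k + 1)).card * n.choose k := by
  have hsub : ∀ l ∈ avoiders (n + 1), (succs l).length ≤ n := by
    intro l hl
    have hlen := (mem_avoiders.1 hl).2.1
    match l, hlen with
    | x :: l, hlen =>
      have := length_succs_lt x l
      omega
  have hcard : ∀ k ≤ n, (avoidersRuns (n + 1) (k + 1)).card =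
      (avoidersRuns (k + 1) (k + 1)).card * n.choose k := by
    intro k hk
    obtain ⟨m, rfl⟩ := Nat.exists_eq_add_of_le hk
    rw [← card_avoidersRuns, show k + m + 1 = k + 1 + m by ring]
  have hmaps : ∀ l ∈ avoiders (n + 1), n - (succs l).length ∈ Finset.range 12 := by
    intro l hl
    have hl' := hsub l hl
    rw [Finset.mem_range]
    by_contra! hge
    have hmem : l ∈ avoidersRuns (n + 1) (n - (succs l).length + 1) :=
      Finset.mem_filter.2 ⟨hl, by omega⟩
    have := Finset.card_pos.2 ⟨l, hmem⟩
    rw [hcard _ (by omega), avoidersRuns_self_eq_empty (by omega)] at this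
    simp at this
  rw [Finset.card_eq_sum_card_fiberwise hmaps]
  refine Finset.sum_congr rfl fun k _ => ?_
  rcases le_or_gt k n with hk | hk
  · rw [← hcard k hk]
    congr 1
    ext l
    simp only [avoidersRuns, Finset.mem_filter]
    refine and_congr_right fun hl => ?_
    have := hsub l hl
    omega
  · rw [Nat.choose_eq_zero_of_lt hk, mul_zero, Finset.card_eq_zero, Finset.filter_eq_empty_iff]
    intro l _
    omega

open Polynomial in
theorem exists_polynomial_eval_choose_pred (k : ℕ) :
    ∃ p : ℚ[X], p.degree ≤ k ∧ ∀ n : ℕ, p.eval ((n + 1 : ℕ) : ℚ) = n.choose k := by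
  refine ⟨C ((k.factorial : ℚ)⁻¹) * (descPochhammer ℚ k).comp (X - C 1), ?_, fun n => ?_⟩
  · refine degree_le_of_natDegree_le ((natDegree_C_mul_le _ _).trans ?_)
    rw [natDegree_comp, natDegree_X_sub_C, descPochhammer_natDegree, mul_one]
  · have hk : (k.factorial : ℚ) ≠ 0 := by positivity
    simp only [eval_mul, eval_C, eval_comp, eval_sub, eval_X, Nat.cast_add, Nat.cast_one,
      add_sub_cancel_right, descPochhammer_eval_eq_descFactorial,
      Nat.descFactorial_eq_factorial_mul_choose, Nat.cast_mul]
    field_simp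

/-- for all large `n`, the number of permutations of length `n` avoiding
`4321` and `1324` is given by a polynomial of degree at most `11`. -/
theorem stmt13 :
    ∃ (p : Polynomial ℚ) (N : ℕ), p.degree ≤ 11 ∧ ∀ n : ℕ, N ≤ n →
      (Set.ncard {l : List ℕ |
          IsPermList l ∧ l.length = n ∧ PAvoids l [4,3,2,1] ∧ PAvoids l [1,3,2,4]} : ℚ) =
        p.eval (n : ℚ) := by
  choose q hdeg heval using exists_polynomial_eval_choose_pred
  refine ⟨∑ k ∈ Finset.range 12, ((avoidersRuns (k + 1) (k + 1)).card : ℚ) • q k, 1,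
    ?_, fun n hn => ?_⟩
  · refine (Polynomial.degree_sum_le _ _).trans (Finset.sup_le fun k hk => ?_)
    refine (Polynomial.degree_smul_le _ _).trans ((hdeg k).trans ?_)
    have : k ≤ 11 := by have := Finset.mem_range.1 hk; omega
    exact_mod_cast this
  · have hset : {l : List ℕ | IsPermList l ∧ l.length = n ∧ PAvoids l [4, 3, 2, 1] ∧
        PAvoids l [1, 3, 2, 4]} = (avoiders n : Set (List ℕ)) := by
      ext l
      simp only [Set.mem_ofPred_eq, Finset.mem_coe, mem_avoiders, pAvoids_4321_1324_iff]
    obtain ⟨m, rfl⟩ := Nat.exists_eq_add_of_le' hn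
    rw [hset, Set.ncard_coe_finset, card_avoiders_succ, Polynomial.eval_finsetSum]
    push_cast
    refine Finset.sum_congr rfl fun k _ => ?_
    have := heval k m
    push_cast at this
    rw [Polynomial.eval_smul, smul_eq_mul, this]
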